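/- There is a constant C_2 > 0 such that there exist arbitrarily large values of x for which the primorial modulus P(x) = ∏_{p < x} p is 'good', i.e. L(s,χ) ≠ 0 for all characters χ mod P(x) and all s = σ+it with σ > 1 - C_2/log(P(x)(|t|+1)). -/

import Mathlib

/-- A modulus `q` is *good* (relative to `C₂`) if no Dirichlet `L`-function mod `q`
vanishes in the region `Re s > 1 - C₂ / log(q(|Im s|+1))`. -/
def IsGoodModulus (C₂ : ℝ) (q : ℕ) [NeZero q] : Prop :=
  ∀ χ : DirichletCharacter ℂ q, ∀ s : ℂ,
    1 - C₂ / Real.log (q * (|s.im| + 1)) < s.re →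
      DirichletCharacter.LFunction χ s ≠ 0

/-- The primorial modulus `P(x) = ∏_{p < x} p`. -/
def primorialBelow (x : ℕ) : ℕ := ∏ p ∈ (Finset.range x).filter Nat.Prime, p


open Complex Metric in
/-- Nonvanishing case of Landau's local lemma. -/
lemma landau_nonvanishing {g : ℂ → ℂ} (hg : Differentiable ℂ g) {R A : ℝ} (hR : 0 < R) (hA : 0 < A)
    (h0 : ∀ z ∈ ball (0:ℂ) R, g z ≠ 0) (hb : ∀ z ∈ ball (0:ℂ) R, ‖g z‖ ≤ Real.exp A * ‖g 0‖) :
    ‖logDeriv g 0‖ ≤ 4 * A / R := by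
  have hd : DifferentiableOn ℂ (logDeriv g) (ball 0 R) := by
    have : DifferentiableOn ℂ (fun z => deriv g z / g z) (ball 0 R) := by
      apply DifferentiableOn.div _ hg.differentiableOn h0
      exact (hg.contDiff (n := 2)).differentiable_deriv_two.differentiableOn
    exact this
  obtain ⟨h, hh0, hh⟩ := (hd.isExactOn_ball).with_val_at 0 0
  have m0 : (0:ℂ) ∈ ball (0:ℂ) R := by simpa using hR
  have hhd : DifferentiableOn ℂ h (ball 0 R) := fun z hz => (hh z hz).differentiableAt.differentiableWithinAt
  -- g = g 0 * exp h
  have key : ∀ z ∈ ball (0:ℂ) R, g z * exp (-h z) = g 0 := by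
    intro z hz
    have := (convex_ball (0:ℂ) R).is_const_of_fderivWithin_eq_zero (𝕜 := ℂ) (f := fun z => g z * exp (-h z)) ?_ ?_ m0 hz
    · simpa [hh0] using this.symm
    · exact hg.differentiableOn.mul (hhd.neg.cexp)
    · intro x hx
      have hD : HasDerivAt (fun z => g z * exp (-h z)) 0 x := by
        have h1 := (hg x).hasDerivAt.mul ((hh x hx).neg.cexp)
        convert! h1 using 1
        have := h0 x hx
        rw [logDeriv_apply]
        field_simp
        simp
      rw [fderivWithin_of_isOpen isOpen_ball hx]
      ext
      simp [hD.deriv]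
  have hre : Set.MapsTo h (ball 0 R) {z | z.re ≤ A} := by
    intro z hz
    have h1 := key z hz
    have h2 : g z = g 0 * exp (h z) := by
      rw [← h1, mul_assoc, ← Complex.exp_add]; simp
    have h3 := hb z hz
    rw [h2, norm_mul, Complex.norm_exp, mul_comm] at h3
    have h4 : 0 < ‖g 0‖ := norm_pos_iff.mpr (h0 0 m0)
    exact Real.exp_le_exp.mp (le_of_mul_le_mul_right h3 h4)
  have hbc : ∀ z ∈ sphere (0:ℂ) (R/2), ‖h z‖ ≤ 2 * A := by
    intro z hz
    have hz' : ‖z‖ = R / 2 := by simpa using hz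
    have := borelCaratheodory_zero hA hhd hre hR (z := z) (by simp [hz']; linarith) hh0
    rw [hz'] at this
    convert this using 1
    field_simp
    ring
  have := norm_deriv_le_of_forall_mem_sphere_norm_le (c := 0) (R := R/2) (f := h) (by linarith)
    (hhd.diffContOnCl_ball (U := ball 0 R) (closedBall_subset_ball (by linarith))) hbc
  rw [(hh 0 m0).deriv] at this
  convert this using 1
  field_simp
  ring

open Complex Metric in
/-- Landau's local lemma, via dividing out zeros by Blaschke factors. -/
lemma landau_local {R A M : ℝ} (hR : 0 < R) (hA : 0 < A) (n : ℕ) : ∀ (f : ℂ → ℂ) (S : Finset ℂ),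
    Differentiable ℂ f → f 0 ≠ 0 → (∀ z ∈ closedBall (0:ℂ) R, ‖f z‖ ≤ M) →
    M ≤ Real.exp A * ‖f 0‖ → M ≤ 2 ^ n * ‖f 0‖ →
    (∀ z ∈ ball (0:ℂ) (R/2), f z = 0 → z.re ≤ 0) →
    (∀ ρ ∈ S, ρ ∈ ball (0:ℂ) (R/2) ∧ f ρ = 0) →
    ∑ ρ ∈ S, (-ρ.re) * (1 / ‖ρ‖^2 - 1 / R^2) - 8 * A / R ≤ (logDeriv f 0).re := by
  -- dividing step
  have step : ∀ (f : ℂ → ℂ) (ρ : ℂ), Differentiable ℂ f → f 0 ≠ 0 →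
      (∀ z ∈ closedBall (0:ℂ) R, ‖f z‖ ≤ M) → ρ ∈ ball (0:ℂ) (R/2) → f ρ = 0 →
      ∃ F : ℂ → ℂ, Differentiable ℂ F ∧ 2 * ‖f 0‖ ≤ ‖F 0‖ ∧ (∀ z ∈ closedBall (0:ℂ) R, ‖F z‖ ≤ M) ∧
        (∀ z ∈ ball (0:ℂ) (R/2), F z = 0 → f z = 0) ∧ (∀ z, z ≠ ρ → f z = 0 → F z = 0) ∧
        (logDeriv f 0).re = (logDeriv F 0).re + (-ρ.re) * (1 / ‖ρ‖^2 - 1 / R^2) := by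
    intro f ρ hf hf0 hb hρ hfρ
    have hρR : ‖ρ‖ < R / 2 := by simpa using hρ
    have hρ0 : ρ ≠ 0 := by rintro rfl; exact hf0 hfρ
    have hR0 : (R:ℂ) ≠ 0 := by exact_mod_cast hR.ne'
    have hds : Differentiable ℂ (dslope f ρ) := by
      rw [← differentiableOn_univ]
      exact (differentiableOn_dslope (Filter.univ_mem)).mpr hf.differentiableOn
    have hfac : ∀ z, f z = (z - ρ) * dslope f ρ z := by
      intro z
      have := sub_smul_dslope f ρ z
      rw [hfρ, sub_zero, smul_eq_mul] at this
      exact this.symm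
    have hcf : ∀ z ∈ closedBall (0:ℂ) R, (R:ℂ)^2 - (starRingEnd ℂ) ρ * z ≠ 0 := by
      intro z hz h
      have hz' : ‖z‖ ≤ R := by simpa using hz
      have h1 : ‖(R:ℂ)^2‖ = ‖(starRingEnd ℂ) ρ * z‖ := by rw [sub_eq_zero.mp h]
      rw [norm_mul, RCLike.norm_conj, norm_pow, Complex.norm_of_nonneg hR.le] at h1
      nlinarith [norm_nonneg z, norm_nonneg ρ]
    set B : ℂ → ℂ := fun z => ((R:ℂ)^2 - (starRingEnd ℂ) ρ * z) / R with hB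
    have hBd : Differentiable ℂ B := by rw [hB]; fun_prop
    have m0 : (0:ℂ) ∈ closedBall (0:ℂ) R := by simpa using hR.le
    have hB0 : ∀ z ∈ closedBall (0:ℂ) R, B z ≠ 0 := fun z hz => div_ne_zero (hcf z hz) hR0
    have hds0 : dslope f ρ 0 ≠ 0 := fun h => hf0 (by rw [hfac 0, h, mul_zero])
    refine ⟨fun z => dslope f ρ z * B z, hds.mul hBd, ?_, ?_, ?_, ?_, ?_⟩
    · rw [hfac 0]
      simp only [hB, mul_zero, sub_zero, zero_sub, norm_mul, norm_neg, norm_div, norm_pow, Complex.norm_of_nonneg hR.le]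
      have : R^2 / R = R := by field_simp
      rw [this]
      nlinarith [norm_nonneg (dslope f ρ 0)]
    · intro z hz
      refine norm_le_of_forall_mem_frontier_norm_le (U := ball (0:ℂ) R) isBounded_ball
        ((hds.mul hBd).diffContOnCl) ?_ (by rwa [closure_ball _ hR.ne'])
      intro w hw
      rw [frontier_ball _ hR.ne'] at hw
      have hwR : ‖w‖ = R := by simpa using hw
      have hw2 := hb w (sphere_subset_closedBall hw)
      rw [hfac w] at hw2
      have : ‖B w‖ = ‖w - ρ‖ := by
        have hc := norm_canonicalFactor_eval_circle_eq_one (w := ρ) (R := R) (z := w) (by simp; linarith) hw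
        rw [canonicalFactor_apply] at hc
        have hne : w - ρ ≠ 0 := by
          intro h; rw [sub_eq_zero.mp h] at hwR; linarith
        rw [norm_div, norm_mul, div_eq_one_iff_eq (by positivity)] at hc
        rw [hB, norm_div, hc, mul_div_assoc, mul_comm, div_mul_cancel₀ _ (by positivity)]
      calc ‖dslope f ρ w * B w‖ = ‖(w - ρ) * dslope f ρ w‖ := by rw [norm_mul, this, norm_mul, mul_comm]
        _ ≤ M := hw2
    · intro z hz h
      have hz' : z ∈ closedBall (0:ℂ) R := ball_subset_closedBall (ball_subset_ball (by linarith) hz)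
      rcases mul_eq_zero.mp h with h | h
      · rw [hfac, h, mul_zero]
      · exact absurd h (hB0 z hz')
    · intro z hz h
      rw [hfac] at h
      rcases mul_eq_zero.mp h with h | h
      · exact absurd (sub_eq_zero.mp h) hz
      · simp [h]
    · have e1 : logDeriv f 0 = logDeriv (fun z => z - ρ) 0 + logDeriv (dslope f ρ) 0 := by
        rw [← logDeriv_mul _ (by simpa using hρ0) hds0 (by fun_prop) (hds 0)]
        congr 1
        funext z; exact hfac z
      have e2 : logDeriv (fun z => dslope f ρ z * B z) 0 = logDeriv (dslope f ρ) 0 + logDeriv B 0 :=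
        logDeriv_mul _ hds0 (hB0 0 m0) (hds 0) (hBd 0)
      have e3 : logDeriv (fun z => z - ρ) 0 = -ρ⁻¹ := by
        rw [logDeriv_apply]
        have : deriv (fun z : ℂ => z - ρ) 0 = 1 := by simp
        rw [this, zero_sub, one_div, inv_neg]
      have e4 : logDeriv B 0 = -(starRingEnd ℂ) ρ / R^2 := by
        have : HasDerivAt B (-(starRingEnd ℂ) ρ / R) 0 := by
          have := (((hasDerivAt_id (0:ℂ)).const_mul ((starRingEnd ℂ) ρ)).const_sub ((R:ℂ)^2)).div_const (R:ℂ)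
          simpa using! this
        rw [logDeriv_apply, this.deriv]
        simp only [hB]
        field_simp
        simp
      rw [e1, e2, e3, e4, add_re, add_re]
      have f1 : (-ρ⁻¹).re = -ρ.re / ‖ρ‖^2 := by
        rw [neg_re, inv_re, Complex.normSq_eq_norm_sq]; ring
      have f2 : (-(starRingEnd ℂ) ρ / (R:ℂ)^2).re = -ρ.re / R^2 := by
        rw [← ofReal_pow, div_ofReal_re]; simp
      rw [f1, f2]
      ring
  have nn : ∀ ρ : ℂ, ρ ≠ 0 → ρ ∈ ball (0:ℂ) (R/2) → ρ.re ≤ 0 → 0 ≤ (-ρ.re) * (1 / ‖ρ‖^2 - 1 / R^2) := by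
    intro ρ h0 h1 h2
    have h1' : ‖ρ‖ < R / 2 := by simpa using h1
    have h3 : 0 < ‖ρ‖ := norm_pos_iff.mpr h0
    apply mul_nonneg (by linarith)
    rw [sub_nonneg]
    apply one_div_le_one_div_of_le (by positivity)
    nlinarith
  have base : ∀ f : ℂ → ℂ, Differentiable ℂ f → f 0 ≠ 0 → (∀ z ∈ closedBall (0:ℂ) R, ‖f z‖ ≤ M) →
    M ≤ Real.exp A * ‖f 0‖ → (∀ z ∈ ball (0:ℂ) (R/2), f z ≠ 0) → - (8 * A / R) ≤ (logDeriv f 0).re := by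
    intro f hf hf0 hb hM hz
    have := landau_nonvanishing hf (R := R/2) (by linarith) hA hz (fun z hz =>
      (hb z (ball_subset_closedBall (ball_subset_ball (by linarith) hz))).trans hM)
    have h2 := neg_le_of_abs_le ((abs_re_le_norm _).trans this)
    have e : 4 * A / (R / 2) = 8 * A / R := by field_simp; ring
    rwa [e] at h2
  induction n with
  | zero =>
    intro f S hf hf0 hb hM hn hre hS
    have hz : ∀ z ∈ ball (0:ℂ) (R/2), f z ≠ 0 := by
      intro z hz h
      obtain ⟨F, -, h1, h2, -⟩ := step f z hf hf0 hb hz h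
      have := h2 0 (by simpa using hR.le)
      have h3 : 0 < ‖f 0‖ := norm_pos_iff.mpr hf0
      simp at hn; linarith
    have : S = ∅ := Finset.eq_empty_of_forall_notMem fun ρ hρ => hz ρ (hS ρ hρ).1 (hS ρ hρ).2
    subst this
    simpa using base f hf hf0 hb hM hz
  | succ n ih =>
    intro f S hf hf0 hb hM hn hre hS
    have h3 : 0 < ‖f 0‖ := norm_pos_iff.mpr hf0
    by_cases hz : ∀ z ∈ ball (0:ℂ) (R/2), f z ≠ 0
    · have : S = ∅ := Finset.eq_empty_of_forall_notMem fun ρ hρ => hz ρ (hS ρ hρ).1 (hS ρ hρ).2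
      subst this
      simpa using base f hf hf0 hb hM hz
    push Not at hz
    obtain ⟨ρ, hρ, hfρ, hSρ⟩ : ∃ ρ ∈ ball (0:ℂ) (R/2), f ρ = 0 ∧ (S.Nonempty → ρ ∈ S) := by
      rcases S.eq_empty_or_nonempty with h | ⟨ρ, h⟩
      · obtain ⟨z, h1, h2⟩ := hz
        exact ⟨z, h1, h2, by simp [h]⟩
      · exact ⟨ρ, (hS ρ h).1, (hS ρ h).2, fun _ => h⟩
    obtain ⟨F, F1, F2, F3, F4, F5, F6⟩ := step f ρ hf hf0 hb hρ hfρ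
    have hF0 : F 0 ≠ 0 := by
      rw [← norm_pos_iff]; linarith
    have hI := ih F (S.erase ρ) F1 hF0 F3
      (hM.trans (by gcongr; linarith))
      (hn.trans (by rw [pow_succ, mul_assoc]; gcongr))
      (fun z hz h => hre z hz (F4 z hz h))
      (fun r hr => ⟨(hS r (Finset.mem_of_mem_erase hr)).1,
        F5 r (Finset.ne_of_mem_erase hr) (hS r (Finset.mem_of_mem_erase hr)).2⟩)
    have hρ0 : ρ ≠ 0 := by rintro rfl; exact hf0 hfρ
    have hnn := nn ρ hρ0 hρ (hre ρ hρ hfρ)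
    rw [F6]
    by_cases hm : ρ ∈ S
    · rw [← Finset.add_sum_erase _ _ hm]; linarith
    · have : S = ∅ := by
        by_contra h; exact hm (hSρ (Finset.nonempty_iff_ne_empty.mpr h))
      subst this
      simp only [Finset.erase_empty, Finset.sum_empty] at hI ⊢; linarith

open Complex Metric in
/-- Landau's local lemma around an arbitrary centre, radius `1/2`. -/
lemma landau_shift {A M : ℝ} (hA : 0 < A) {f : ℂ → ℂ} (hf : Differentiable ℂ f) (s₀ : ℂ)
    (hf0 : f s₀ ≠ 0) (hb : ∀ z ∈ closedBall s₀ (1/2), ‖f z‖ ≤ M) (hM : M ≤ Real.exp A * ‖f s₀‖)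
    (hre : ∀ z, f z = 0 → z.re ≤ s₀.re) (S : Finset ℂ) (hS : ∀ ρ ∈ S, ‖s₀ - ρ‖ < 1/4 ∧ f ρ = 0) :
    ∑ ρ ∈ S, (1 / (s₀ - ρ)).re - S.card - 16 * A ≤ (logDeriv f s₀).re := by
  obtain ⟨n, hn⟩ := pow_unbounded_of_one_lt (Real.exp A) (one_lt_two (α := ℝ))
  have key := landau_local (R := 1/2) (A := A) (M := M) (by norm_num) hA n (fun z => f (z + s₀))
    (S.image (fun ρ => ρ - s₀)) (by fun_prop) (by simpa using hf0)
    (fun z hz => hb _ (by simpa using hz)) (by simpa using hM)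
    (by
      refine hM.trans ?_
      simp only [zero_add]
      gcongr)
    (fun z _ h => by have := hre _ h; simp at this; exact this)
    (by
      intro ρ hρ
      simp only [Finset.mem_image] at hρ
      obtain ⟨r, hr, rfl⟩ := hρ
      have := hS r hr
      refine ⟨?_, by simpa using this.2⟩
      rw [mem_ball_zero_iff, norm_sub_rev]; linarith [this.1])
  rw [Finset.sum_image (by intro a _ b _ h; simpa using h)] at key
  have e : logDeriv (fun z => f (z + s₀)) 0 = logDeriv f s₀ := by
    rw [logDeriv_apply, logDeriv_apply, deriv_comp_add_const]; simp
  rw [e] at key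
  refine le_trans ?_ key
  have h1 : ∑ ρ ∈ S, ((1 / (s₀ - ρ)).re - 1) ≤
      ∑ x ∈ S, -(x - s₀).re * (1 / ‖x - s₀‖ ^ 2 - 1 / (1 / 2) ^ 2) := by
    apply Finset.sum_le_sum
    intro ρ hρ
    have h := (hS ρ hρ).1
    have h2 : (1 / (s₀ - ρ)).re = -(ρ - s₀).re / ‖ρ - s₀‖^2 := by
      rw [one_div, inv_re, Complex.normSq_eq_norm_sq, norm_sub_rev]; simp
    rw [h2]
    have h3 : -(ρ - s₀).re ≤ 1/4 := by
      have := (le_abs_self _).trans (abs_re_le_norm (s₀ - ρ))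
      simp at this ⊢; linarith
    have : -(ρ - s₀).re * (1 / ‖ρ - s₀‖ ^ 2 - 1 / (1 / 2) ^ 2) = -(ρ - s₀).re / ‖ρ - s₀‖ ^ 2 - 4 * (-(ρ - s₀).re) := by
      ring
    rw [this]
    linarith
  rw [Finset.sum_sub_distrib] at h1
  simp only [Finset.sum_const, nsmul_eq_mul, mul_one] at h1
  have : 8 * A / (1/2) = 16 * A := by ring
  rw [this]
  linarith


open Complex MeasureTheory Set in
/-- Partial summation: continuation to `Re s > 0` with a bound. -/
lemma LSeries_continuation (a : ℕ → ℂ) (δ : ℂ) (K : ℝ)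
    (hK : ∀ t : ℝ, 1 ≤ t → ‖∑ k ∈ Finset.Icc 1 ⌊t⌋₊, a k - δ * t‖ ≤ K)
    (hs : ∀ s : ℂ, 1 < s.re → LSeriesSummable a s) :
    ∃ H : ℂ → ℂ, DifferentiableOn ℂ H {s | 0 < s.re} ∧
      (∀ s : ℂ, 1/2 ≤ s.re → ‖H s‖ ≤ 2 * K * ‖s‖) ∧
      ∀ s : ℂ, 1 < s.re → LSeries a s = H s + δ * (s / (s - 1)) := by
  have hK0 : 0 ≤ K := (norm_nonneg _).trans (hK 1 le_rfl)
  set D : ℝ → ℂ := fun t => ∑ k ∈ Finset.Icc 1 ⌊t⌋₊, a k - δ * t with hD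
  set f : ℝ → ℂ := (Ioi (1:ℝ)).indicator D with hf
  have hDm : Measurable D := by
    rw [hD]
    have : Measurable (fun t : ℝ => ∑ k ∈ Finset.Icc 1 ⌊t⌋₊, a k) :=
      (measurable_from_nat (f := fun n : ℕ => ∑ k ∈ Finset.Icc 1 n, a k)).comp Nat.measurable_floor
    fun_prop
  have hfm : Measurable f := hDm.indicator measurableSet_Ioi
  have hfb : ∀ t, ‖f t‖ ≤ K := by
    intro t
    rw [hf, indicator]
    split_ifs with h
    · exact hK t (le_of_lt h)
    · simpa using hK0
  have hfl : LocallyIntegrable f := by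
    refine (locallyIntegrable_const K).mono hfm.aestronglyMeasurable ?_
    filter_upwards with t
    rw [Real.norm_of_nonneg hK0]; exact hfb t
  have hmel : ∀ s : ℂ, mellin f (-s) = ∫ t in Ioi (1:ℝ), D t * (t:ℂ) ^ (-(s+1)) := by
    intro s
    rw [mellin]
    have e1 : ∀ t : ℝ, (t:ℂ) ^ (-s - 1) • f t = (Ioi (1:ℝ)).indicator (fun t : ℝ => D t * (t:ℂ) ^ (-(s+1))) t := by
      intro t
      rw [hf, indicator, indicator]
      split_ifs
      · rw [smul_eq_mul, mul_comm]; congr 2; ring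
      · simp
    simp_rw [e1]
    rw [setIntegral_indicator measurableSet_Ioi]
    congr 2
    ext x; simp
  refine ⟨fun s => s * mellin f (-s), ?_, ?_, ?_⟩
  · intro s hs0
    have hs0' : 0 < s.re := hs0
    apply DifferentiableAt.differentiableWithinAt
    have : DifferentiableAt ℂ (mellin f) (-s) := by
      apply mellin_differentiableAt_of_isBigO_rpow (a := 0) (b := -s.re - 1) (hfl.locallyIntegrableOn _)
      · simp only [neg_zero, Real.rpow_zero]
        exact Asymptotics.IsBigO.of_bound K (by filter_upwards with t; simpa using hfb t)
      · simpa using hs0'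
      · apply Asymptotics.IsBigO.of_bound 0
        have : Iio (1:ℝ) ∈ nhdsWithin 0 (Ioi (0:ℝ)) := mem_nhdsWithin_of_mem_nhds (Iio_mem_nhds one_pos)
        filter_upwards [this] with t ht
        have : t ∉ Ioi (1:ℝ) := by simp at ht ⊢; linarith
        simp [hf, this]
      · simp
    have h2 : DifferentiableAt ℂ (mellin f ∘ fun z => -z) s :=
      DifferentiableAt.comp (g := mellin f) (f := fun z => -z) s this differentiableAt_id.neg
    exact differentiableAt_id.mul h2
  · intro s hs0
    have h1 : ‖mellin f (-s)‖ ≤ 2 * K := by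
      rw [hmel]
      have hi : IntegrableOn (fun t : ℝ => K * t ^ (-(3/2) : ℝ)) (Ioi 1) :=
        (integrableOn_Ioi_rpow_of_lt (by norm_num) one_pos).const_mul K
      have h2 := norm_integral_le_of_norm_le (μ := volume.restrict (Ioi (1:ℝ))) (f := fun t : ℝ => D t * (t:ℂ) ^ (-(s+1))) hi ?_
      · refine h2.trans ?_
        rw [integral_const_mul, integral_Ioi_rpow_of_lt (by norm_num) one_pos]
        norm_num
        linarith
      · filter_upwards [ae_restrict_mem measurableSet_Ioi] with t ht
        have ht' : (1:ℝ) < t := ht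
        rw [norm_mul, norm_cpow_eq_rpow_re_of_pos (by linarith)]
        gcongr
        · exact hK t ht'.le
        · exact ht'.le
        · simp; linarith
    rw [norm_mul]
    nlinarith [norm_nonneg s]
  · intro s hs1
    have hsub : ∀ t : ℝ, 1 < t → ∑ k ∈ Finset.Icc 1 ⌊t⌋₊, a k = D t + δ * t := by
      intro t _; simp [hD]
    have hbig : (fun n : ℕ => ∑ k ∈ Finset.Icc 1 n, a k) =O[Filter.atTop] fun n => (n:ℝ) ^ (1:ℝ) := by
      apply Asymptotics.IsBigO.of_bound (K + ‖δ‖)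
      filter_upwards [Filter.eventually_ge_atTop 1] with n hn
      have hn' : (1:ℝ) ≤ n := by exact_mod_cast hn
      have := hK n hn'
      rw [Nat.floor_natCast] at this
      have h2 := norm_le_norm_add_norm_sub' (∑ k ∈ Finset.Icc 1 n, a k) (δ * (n:ℝ))
      rw [norm_mul] at h2
      simp only [Real.rpow_one, Real.norm_natCast, ofReal_natCast, Complex.norm_natCast] at *
      nlinarith [norm_nonneg δ]
    beta_reduce
    rw [LSeries_eq_mul_integral a zero_le_one hs1 (hs s hs1) hbig, hmel]
    have hint1 : IntegrableOn (fun t : ℝ => D t * (t:ℂ) ^ (-(s+1))) (Ioi 1) := by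
      have hg : IntegrableOn (fun t : ℝ => K * ‖(t:ℂ) ^ (-(s+1))‖) (Ioi 1) :=
        ((integrableOn_Ioi_cpow_of_lt (by simp; linarith) one_pos).norm).const_mul K
      refine Integrable.mono' hg ?_ ?_
      · apply (hDm.aestronglyMeasurable).mul
        exact (integrableOn_Ioi_cpow_of_lt (a := -(s+1)) (by simp; linarith) one_pos).aestronglyMeasurable
      · filter_upwards [ae_restrict_mem measurableSet_Ioi] with t ht
        rw [norm_mul]
        gcongr
        exact hK t (le_of_lt ht)
    have hint2 : IntegrableOn (fun t : ℝ => δ * (t:ℂ) ^ (-s)) (Ioi 1) :=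
      (integrableOn_Ioi_cpow_of_lt (by simp; linarith) one_pos).const_mul δ
    have e : ∫ t in Ioi (1:ℝ), (∑ k ∈ Finset.Icc 1 ⌊t⌋₊, a k) * (t:ℂ) ^ (-(s+1)) =
        ∫ t in Ioi (1:ℝ), (D t * (t:ℂ) ^ (-(s+1)) + δ * (t:ℂ) ^ (-s)) := by
      apply setIntegral_congr_fun measurableSet_Ioi
      intro t ht
      have ht' : (1:ℝ) < t := ht
      have ht0 : (t:ℂ) ≠ 0 := by exact_mod_cast (by linarith : t ≠ 0)
      simp only
      rw [hsub t ht', add_mul]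
      congr 1
      rw [mul_assoc]
      congr 1
      rw [show -s = -(s+1) + 1 by ring, cpow_add _ _ ht0, cpow_one, mul_comm]
    rw [e, integral_add hint1 hint2, integral_const_mul, integral_Ioi_cpow_of_lt (by simp; linarith) one_pos]
    have hne : s - 1 ≠ 0 := by
      intro h; rw [sub_eq_zero.mp h] at hs1; simp at hs1
    have hne' : -s + 1 ≠ 0 := by
      intro h; apply hne; linear_combination -h
    simp only [ofReal_one, one_cpow]
    field_simp
    ring_nf

lemma periodic_sum_bound (q : ℕ) (hq : 0 < q) (g : ℕ → ℂ) (B : ℝ) (hB : ∀ n, ‖g n‖ ≤ B)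
    (hper : ∀ n, g (n + q) = g n) (h0 : ∑ k ∈ Finset.range q, g k = 0) (n : ℕ) :
    ‖∑ k ∈ Finset.range n, g k‖ ≤ q * B := by
  induction n using Nat.strong_induction_on with
  | _ n ih =>
    by_cases h : n < q
    · calc _ ≤ ∑ k ∈ Finset.range n, ‖g k‖ := norm_sum_le _ _
        _ ≤ ∑ k ∈ Finset.range n, B := Finset.sum_le_sum fun _ _ => hB _
        _ = n * B := by simp
        _ ≤ q * B := by
          have : 0 ≤ B := (norm_nonneg _).trans (hB 0)
          gcongr
    · obtain ⟨m, rfl⟩ := Nat.exists_eq_add_of_le (not_lt.mp h)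
      rw [Finset.sum_range_add, h0, zero_add]
      simp_rw [add_comm q, hper]
      exact ih m (by omega)

open DirichletCharacter in
/-- Approximation of the partial sums of a Dirichlet character. -/
lemma char_partial_sum (q : ℕ) [NeZero q] (χ : DirichletCharacter ℂ q) :
    ∃ δ : ℂ, ‖δ‖ ≤ 1 ∧ (χ ≠ 1 → δ = 0) ∧
      ∀ t : ℝ, 1 ≤ t → ‖∑ k ∈ Finset.Icc 1 ⌊t⌋₊, χ (k : ZMod q) - δ * t‖ ≤ 5 * q := by
  have hq : 0 < q := NeZero.pos q
  have hq1 : (1:ℝ) ≤ q := by exact_mod_cast hq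
  have hqc : (q:ℂ) ≠ 0 := by exact_mod_cast hq.ne'
  set δ : ℂ := (∑ k ∈ Finset.range q, χ (k : ZMod q)) / q with hδ
  have hδ1 : ‖δ‖ ≤ 1 := by
    rw [hδ, norm_div, Complex.norm_natCast, div_le_one (by positivity)]
    calc _ ≤ ∑ k ∈ Finset.range q, ‖χ (k : ZMod q)‖ := norm_sum_le _ _
      _ ≤ ∑ k ∈ Finset.range q, (1:ℝ) := Finset.sum_le_sum fun _ _ => χ.norm_le_one _
      _ = q := by simp
  have hsum : ∑ k ∈ Finset.range q, χ (k : ZMod q) = ∑ j : ZMod q, χ j := by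
    symm
    apply Finset.sum_nbij' (fun (j : ZMod q) => j.val) (fun (k : ℕ) => (k : ZMod q))
    · intro j _; simpa using j.val_lt
    · simp
    · intro j _; simp
    · intro k hk; exact ZMod.val_cast_of_lt (by simpa using hk)
    · intro j _; simp
  refine ⟨δ, hδ1, ?_, ?_⟩
  · intro h
    rw [hδ, hsum, MulChar.sum_eq_zero_of_ne_one h]; simp
  · intro t ht
    have hb := periodic_sum_bound q hq (fun k : ℕ => χ (k : ZMod q) - δ) 2
      (fun n => (norm_sub_le _ _).trans (by linarith [χ.norm_le_one (n : ZMod q)]))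
      (fun n => by simp)
      (by rw [Finset.sum_sub_distrib]; simp [hδ]; field_simp; simp) (⌊t⌋₊ + 1)
    have e : ∑ k ∈ Finset.Icc 1 ⌊t⌋₊, χ (k : ZMod q) =
        ∑ k ∈ Finset.range (⌊t⌋₊ + 1), (χ (k : ZMod q) - δ) - (χ ((0:ℕ) : ZMod q) - δ) + ⌊t⌋₊ * δ := by
      rw [Finset.sum_range_succ', add_sub_cancel_right, Finset.range_eq_Ico, Finset.sum_Ico_add' (fun k : ℕ => χ (k : ZMod q) - δ),
        Finset.sum_sub_distrib]
      have : Finset.Ico (0 + 1) (⌊t⌋₊ + 1) = Finset.Icc 1 ⌊t⌋₊ := by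
        ext; simp
      rw [this]; simp
    have e2 : ∑ k ∈ Finset.Icc 1 ⌊t⌋₊, χ (k : ZMod q) - δ * t =
        ∑ k ∈ Finset.range (⌊t⌋₊ + 1), (χ (k : ZMod q) - δ) - (χ ((0:ℕ) : ZMod q) - δ) - δ * ((t - ⌊t⌋₊ : ℝ) : ℂ) := by
      rw [e]; push_cast; ring
    rw [e2]
    have h3 : ‖δ * ((t - ⌊t⌋₊ : ℝ) : ℂ)‖ ≤ 1 := by
      rw [norm_mul, Complex.norm_real, Real.norm_eq_abs, abs_le.mpr ⟨by linarith [Nat.floor_le (show 0 ≤ t by linarith)], (by linarith [Nat.lt_floor_add_one t] : t - ⌊t⌋₊ ≤ 1)⟩ |> fun h => (abs_of_nonneg (by linarith [Nat.floor_le (show 0 ≤ t by linarith)] : 0 ≤ t - (⌊t⌋₊:ℝ)))]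
      have := Nat.lt_floor_add_one t
      have := Nat.floor_le (show 0 ≤ t by linarith)
      nlinarith [norm_nonneg δ]
    have h4 : ‖χ ((0:ℕ) : ZMod q) - δ‖ ≤ 2 := (norm_sub_le _ _).trans (by linarith [χ.norm_le_one ((0:ℕ) : ZMod q)])
    calc _ ≤ _ := norm_sub_le _ _
      _ ≤ (‖∑ k ∈ Finset.range (⌊t⌋₊ + 1), (χ (k : ZMod q) - δ)‖ + ‖χ ((0:ℕ) : ZMod q) - δ‖) + ‖δ * ((t - ⌊t⌋₊ : ℝ) : ℂ)‖ := by
        gcongr; exact norm_sub_le _ _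
      _ ≤ (q * 2 + 2) + 1 := by gcongr
      _ ≤ 5 * q := by linarith

open Complex DirichletCharacter in
/-- The entire function attached to a Dirichlet character. -/
noncomputable def Gfun {q : ℕ} [NeZero q] (χ : DirichletCharacter ℂ q) : ℂ → ℂ :=
  open Classical in if χ = 1 then LFunctionTrivChar₁ q else LFunction χ

open Complex DirichletCharacter in
lemma Gfun_diff {q : ℕ} [NeZero q] (χ : DirichletCharacter ℂ q) : Differentiable ℂ (Gfun χ) := by
  unfold Gfun
  split_ifs with h
  · exact differentiable_LFunctionTrivChar₁ q
  · exact differentiable_LFunction h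

open Complex DirichletCharacter in
lemma Gfun_bound {q : ℕ} [NeZero q] (χ : DirichletCharacter ℂ q) (s : ℂ) (hs : 1/2 ≤ s.re) :
    ‖Gfun χ s‖ ≤ 10 * q * ‖s‖ * (1 + ‖s - 1‖) + ‖s‖ := by
  obtain ⟨δ, hδ1, hδ0, hb⟩ := char_partial_sum q χ
  obtain ⟨H, hHd, hHb, hHe⟩ := LSeries_continuation (fun n : ℕ => χ (n : ZMod q)) δ (5 * q) hb
    (fun s hs => ZMod.LSeriesSummable_of_one_lt_re χ hs)
  have hopen : IsOpen {s : ℂ | 0 < s.re} := isOpen_lt continuous_const continuous_re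
  have hpre : IsPreconnected {s : ℂ | 0 < s.re} := (convex_halfSpace_re_gt 0).isPreconnected
  have hopen2 : IsOpen {s : ℂ | 1 < s.re} := isOpen_lt continuous_const continuous_re
  have key : ∀ F₁ F₂ : ℂ → ℂ, DifferentiableOn ℂ F₁ {s : ℂ | 0 < s.re} →
      DifferentiableOn ℂ F₂ {s : ℂ | 0 < s.re} → (∀ z : ℂ, 1 < z.re → F₁ z = F₂ z) → F₁ s = F₂ s := by
    intro F₁ F₂ h1 h2 h
    have := (h1.analyticOnNhd hopen).eqOn_of_preconnected_of_eventuallyEq (h2.analyticOnNhd hopen) hpre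
      (z₀ := 2) (by simp) ?_
    · exact this (show 0 < s.re by linarith)
    · filter_upwards [hopen2.mem_nhds (show (2:ℂ) ∈ {s : ℂ | 1 < s.re} by simp)] with z hz
      exact h z hz
  have hH := hHb s hs
  have hq1 : (1:ℝ) ≤ q := by exact_mod_cast NeZero.pos q
  have hqs : 0 ≤ (q:ℝ) * ‖s‖ := by positivity
  by_cases h : χ = 1
  · have e : Gfun χ s = (s - 1) * H s + δ * s := by
      refine key (Gfun χ) (fun s => (s - 1) * H s + δ * s) (Gfun_diff χ).differentiableOn ?_ ?_
      · fun_prop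
      · intro z hz
        have hz1 : z ≠ 1 := by rintro rfl; simp at hz
        have hz1' : z - 1 ≠ 0 := sub_ne_zero.mpr hz1
        subst h
        simp only [Gfun, if_true]
        rw [LFunctionTrivChar₁, Function.update_of_ne hz1]
        rw [LFunctionTrivChar, LFunction_eq_LSeries _ hz, hHe z hz]
        field_simp
    rw [e]
    calc _ ≤ ‖(s - 1) * H s‖ + ‖δ * s‖ := norm_add_le _ _
      _ = ‖s-1‖ * ‖H s‖ + ‖δ‖ * ‖s‖ := by rw [norm_mul, norm_mul]
      _ ≤ ‖s-1‖ * (2 * (5 * q) * ‖s‖) + 1 * ‖s‖ := by gcongr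
      _ ≤ _ := by nlinarith
  · have e : Gfun χ s = H s := by
      refine key (Gfun χ) H (Gfun_diff χ).differentiableOn hHd ?_
      intro z hz
      simp only [Gfun, h, if_false]
      rw [LFunction_eq_LSeries _ hz, hHe z hz, hδ0 h]; simp
    rw [e]
    nlinarith [norm_nonneg (s-1), norm_nonneg s, mul_nonneg hqs (norm_nonneg (s-1))]


open Complex in
lemma zeta_sum_bound (σ : ℝ) (h1 : 1 < σ) (h2 : σ ≤ 3/2) :
    ∑' n : ℕ, ‖LSeries.term (1 : ℕ → ℂ) (σ:ℂ) n‖ ≤ 3 / (σ - 1) := by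
  obtain ⟨H, -, hHb, hHe⟩ := LSeries_continuation (1 : ℕ → ℂ) 1 1 (by
    intro t ht
    have a1 := Nat.floor_le (show 0 ≤ t by linarith)
    have a2 := Nat.lt_floor_add_one t
    have : (∑ k ∈ Finset.Icc 1 ⌊t⌋₊, (1 : ℕ → ℂ) k - 1 * (t:ℂ)) = ((⌊t⌋₊ - t : ℝ) : ℂ) := by simp
    rw [this, Complex.norm_real, Real.norm_eq_abs, abs_le]
    constructor <;> linarith) (fun s hs => LSeriesSummable_one_iff.mpr hs)
  have hσ : 1 < (σ:ℂ).re := by simpa using h1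
  have e : LSeries (1 : ℕ → ℂ) (σ:ℂ) = ((∑' n : ℕ, ‖LSeries.term (1 : ℕ → ℂ) (σ:ℂ) n‖ : ℝ) : ℂ) := by
    rw [LSeries, ofReal_tsum]
    congr 1; ext n
    rw [LSeries.norm_term_eq, LSeries.term]
    split_ifs with h
    · simp
    · simp [ofReal_cpow (Nat.cast_nonneg n) σ]
  have h0 : 0 ≤ ∑' n : ℕ, ‖LSeries.term (1 : ℕ → ℂ) (σ:ℂ) n‖ := tsum_nonneg fun _ => norm_nonneg _
  have e2 : ∑' n : ℕ, ‖LSeries.term (1 : ℕ → ℂ) (σ:ℂ) n‖ = ‖LSeries (1 : ℕ → ℂ) (σ:ℂ)‖ := by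
    rw [e, Complex.norm_real, Real.norm_of_nonneg h0]
  rw [e2, hHe _ hσ]
  have b := hHb (σ:ℂ) (by linarith)
  have : (1:ℂ) * (σ / (σ - 1)) = ((σ / (σ-1) : ℝ) : ℂ) := by push_cast; ring
  have ha : 0 < σ - 1 := by linarith
  rw [this]
  refine (norm_add_le _ _).trans ?_
  rw [Complex.norm_real, Real.norm_of_nonneg (by positivity)] at *
  have : 3 / (σ-1) = 3/2 / (σ-1) + 3/2/(σ-1) := by ring
  have h3 : 3 ≤ 3/2/(σ-1) := by rw [le_div_iff₀ ha]; linarith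
  have h4 : σ/(σ-1) ≤ 3/2/(σ-1) := by gcongr
  linarith

open Complex DirichletCharacter ArithmeticFunction in
lemma LFunction_lower {q : ℕ} [NeZero q] (χ : DirichletCharacter ℂ q) (s : ℂ) (h1 : 1 < s.re)
    (h2 : s.re ≤ 3/2) : (s.re - 1) / 3 ≤ ‖LFunction χ s‖ := by
  have hm := LSeries.mul_mu_eq_one χ h1
  rw [LFunction_eq_LSeries _ h1]
  have hb : ‖LSeries ((fun n : ℕ => χ (n : ZMod q)) * fun n : ℕ => ((ArithmeticFunction.moebius n : ℤ) : ℂ)) s‖ ≤ 3 / (s.re - 1) := by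
    refine le_trans ?_ (zeta_sum_bound s.re h1 h2)
    have hsum : Summable fun n : ℕ => ‖LSeries.term (1 : ℕ → ℂ) (s.re:ℂ) n‖ :=
      (LSeriesSummable_one_iff.mpr (by simpa using h1) : LSeriesSummable 1 (s.re : ℂ)).norm
    refine tsum_of_norm_bounded hsum.hasSum ?_
    intro n
    rw [LSeries.norm_term_eq, LSeries.norm_term_eq]
    split_ifs with hn
    · exact le_rfl
    · simp only [ofReal_re]
      gcongr
      simp only [Pi.mul_apply, Pi.one_apply, norm_mul, norm_one]
      have a1 := χ.norm_le_one (n : ZMod q)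
      have a2 : ‖((ArithmeticFunction.moebius n : ℤ) : ℂ)‖ ≤ 1 := by
        rw [Complex.norm_intCast]
        exact_mod_cast ArithmeticFunction.abs_moebius_le_one
      nlinarith [norm_nonneg (χ (n : ZMod q)), norm_nonneg ((ArithmeticFunction.moebius n : ℤ) : ℂ)]
  have hn := congrArg norm hm
  rw [norm_mul, norm_one] at hn
  have ha : 0 < s.re - 1 := by linarith
  rw [le_div_iff₀ ha] at hb
  have h5 := norm_nonneg (LSeries (fun n : ℕ => χ (n : ZMod q)) s)
  nlinarith [mul_le_mul_of_nonneg_left hb h5]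

open Complex DirichletCharacter in
lemma Gfun_of_ne {q : ℕ} [NeZero q] {χ : DirichletCharacter ℂ q} (h : χ ≠ 1) : Gfun χ = LFunction χ := by
  simp [Gfun, h]

open Complex DirichletCharacter in
lemma Gfun_one {q : ℕ} [NeZero q] {s : ℂ} (h : s ≠ 1) :
    Gfun (1 : DirichletCharacter ℂ q) s = (s - 1) * LFunction (1 : DirichletCharacter ℂ q) s := by
  simp [Gfun, LFunctionTrivChar₁, Function.update_of_ne h]

open Complex DirichletCharacter in
lemma Gfun_ne_zero {q : ℕ} [NeZero q] (χ : DirichletCharacter ℂ q) {s : ℂ} (h : 1 ≤ s.re) :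
    Gfun χ s ≠ 0 := by
  by_cases hχ : χ = 1
  · subst hχ
    by_cases hs : s = 1
    · subst hs; simp only [Gfun, if_true]; exact LFunctionTrivChar₁_apply_one_ne_zero q
    · rw [Gfun_one hs]
      exact mul_ne_zero (sub_ne_zero.mpr hs) (LFunction_ne_zero_of_one_le_re _ (Or.inr hs) h)
  · rw [Gfun_of_ne hχ]; exact LFunction_ne_zero_of_one_le_re _ (Or.inl hχ) h

open Complex DirichletCharacter in
lemma logDeriv_Gfun {q : ℕ} [NeZero q] (χ : DirichletCharacter ℂ q) {s : ℂ} (h : 1 < s.re) :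
    logDeriv (Gfun χ) s = deriv (LFunction χ) s / LFunction χ s +
      (open Classical in if χ = 1 then 1 / (s - 1) else 0) := by
  have hs : s ≠ 1 := by rintro rfl; simp at h
  have hs' : s - 1 ≠ 0 := sub_ne_zero.mpr hs
  by_cases hχ : χ = 1
  · subst hχ
    have hL := LFunction_ne_zero_of_one_le_re (1 : DirichletCharacter ℂ q) (Or.inr hs) h.le
    rw [logDeriv_apply, Gfun_one hs]
    have : Gfun (1 : DirichletCharacter ℂ q) = LFunctionTrivChar₁ q := by simp [Gfun]
    rw [this, deriv_LFunctionTrivChar₁_apply_of_ne_one _ hs, LFunctionTrivChar]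
    simp only [if_true]
    field_simp
  · rw [Gfun_of_ne hχ, logDeriv_apply]; simp [hχ]

open Complex DirichletCharacter in
lemma key_bound {q : ℕ} [NeZero q] (χ : DirichletCharacter ℂ q) (s₀ : ℂ) (h1 : 1 < s₀.re)
    (h2 : s₀.re ≤ 3/2) (L : ℝ) (hL : 1 ≤ L) (hq : q * (|s₀.im| + 1) ≤ Real.exp L)
    (ha : 1 ≤ (s₀.re - 1) * Real.exp L) (S : Finset ℂ) (hc : S.card ≤ 2)
    (hS : ∀ ρ ∈ S, ‖s₀ - ρ‖ < 1/4 ∧ Gfun χ ρ = 0) :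
    (- (deriv (LFunction χ) s₀ / LFunction χ s₀)).re ≤
      (open Classical in if χ = 1 then (1 / (s₀ - 1)).re else 0) - ∑ ρ ∈ S, (1 / (s₀ - ρ)).re + 146 * L := by
  set a := s₀.re - 1 with hadef
  have ha0 : 0 < a := by linarith
  set τ := |s₀.im| + 1 with hτ
  have hτ1 : 1 ≤ τ := by linarith [abs_nonneg s₀.im]
  have hq1 : (1:ℝ) ≤ q := by exact_mod_cast NeZero.pos q
  have hs : s₀ ≠ 1 := by rintro rfl; simp at h1
  have hlow : a ^ 2 / 3 ≤ ‖Gfun χ s₀‖ := by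
    have h := LFunction_lower χ s₀ h1 h2
    by_cases hχ : χ = 1
    · subst hχ
      rw [Gfun_one hs, norm_mul]
      have : a ≤ ‖s₀ - 1‖ := by
        have := Complex.re_le_norm (s₀ - 1); simp at this; linarith
      calc a^2/3 = a * (a/3) := by ring
        _ ≤ _ := by gcongr
    · rw [Gfun_of_ne hχ]; nlinarith
  have hup : ∀ z ∈ Metric.closedBall s₀ (1/2), ‖Gfun χ z‖ ≤ 42 * q * τ ^ 2 := by
    intro z hz
    rw [Metric.mem_closedBall, dist_eq_norm] at hz
    have r := Complex.abs_re_le_norm (z - s₀)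
    have i := Complex.abs_im_le_norm (z - s₀)
    have hzr : 1/2 ≤ z.re := by
      have := (abs_le.mp (r.trans hz)).1
      simp at this; linarith
    have n1 : ‖s₀‖ ≤ 3/2 + |s₀.im| := by
      refine (Complex.norm_le_abs_re_add_abs_im s₀).trans ?_
      rw [abs_of_pos (by linarith)]; linarith
    have n2 : ‖s₀ - 1‖ ≤ 1/2 + |s₀.im| := by
      refine (Complex.norm_le_abs_re_add_abs_im _).trans ?_
      simp only [sub_re, one_re, sub_im, one_im, sub_zero]
      rw [abs_of_pos (by linarith)]; linarith
    have n3 : ‖z‖ ≤ 2 * τ := by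
      have := norm_add_le (z - s₀) s₀
      simp at this; linarith [abs_nonneg s₀.im]
    have n4 : ‖z - 1‖ ≤ τ := by
      have := norm_add_le (z - s₀) (s₀ - 1)
      simp at this; linarith [abs_nonneg s₀.im]
    calc _ ≤ _ := Gfun_bound χ z hzr
      _ ≤ 10 * q * (2 * τ) * (τ + τ) + 2 * τ := by gcongr
      _ ≤ _ := by nlinarith
  have hM : 42 * q * τ ^ 2 ≤ Real.exp (9 * L) * ‖Gfun χ s₀‖ := by
    have hE : Real.exp 5 * (Real.exp L)^4 ≤ Real.exp (9 * L) := by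
      rw [← Real.exp_nat_mul, ← Real.exp_add]; apply Real.exp_le_exp.mpr; push_cast; linarith
    have h5 : (126:ℝ) ≤ Real.exp 5 := by
      have : Real.exp 5 = (Real.exp 1) ^ 5 := by rw [← Real.exp_nat_mul]; norm_num
      rw [this]
      have := Real.exp_one_gt_d9
      calc (126:ℝ) ≤ 2.7 ^ 5 := by norm_num
        _ ≤ _ := by gcongr; linarith
    have e1 : q * τ ^ 2 ≤ (Real.exp L)^2 := by
      calc _ ≤ (q * τ)^2 := by rw [mul_pow]; gcongr; nlinarith
        _ ≤ _ := by gcongr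
    have e2 : 1 ≤ a^2 * (Real.exp L)^2 := by rw [← mul_pow]; exact one_le_pow₀ ha
    calc 42 * q * τ ^ 2 = 42 * (q * τ^2) * 1 := by ring
      _ ≤ 42 * (Real.exp L)^2 * (a^2 * (Real.exp L)^2) := by gcongr
      _ = 126 * (Real.exp L)^4 * (a^2/3) := by ring
      _ ≤ Real.exp 5 * (Real.exp L)^4 * (a^2/3) := by gcongr
      _ ≤ _ := by gcongr
  have := landau_shift (A := 9 * L) (by linarith) (Gfun_diff χ) s₀ (Gfun_ne_zero χ h1.le) hup hM
    (fun z hz => by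
      by_contra hcon
      exact Gfun_ne_zero χ (s := z) (by linarith) hz) S hS
  rw [logDeriv_Gfun χ h1, add_re] at this
  have hc' : (S.card : ℝ) ≤ 2 := by exact_mod_cast hc
  rw [neg_re]
  split_ifs at this ⊢
  · linarith
  · simp only [zero_re] at this; linarith


lemma unit_pos (z w : ℂ) (hz : ‖z‖ = 1) (hw : ‖w‖ = 1) :
    0 ≤ 3 + 2 * z.re + 2 * w.re + 2 * (z * w⁻¹).re := by
  have hw' : w⁻¹ = (starRingEnd ℂ) w := by
    rw [Complex.inv_def, Complex.normSq_eq_norm_sq, hw]; simp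
  rw [hw']
  have h1 : z.re ^ 2 + z.im ^ 2 = 1 := by
    have := Complex.sq_norm z; rw [hz, Complex.normSq_apply] at this; linarith
  have h2 : w.re ^ 2 + w.im ^ 2 = 1 := by
    have := Complex.sq_norm w; rw [hw, Complex.normSq_apply] at this; linarith
  simp only [Complex.mul_re, Complex.conj_re, Complex.conj_im]
  nlinarith [sq_nonneg (1 + z.re + w.re), sq_nonneg (z.im + w.im)]

open Complex DirichletCharacter in
/-- The negative logarithmic derivative of a Dirichlet L-function. -/
noncomputable def Ld {q : ℕ} [NeZero q] (χ : DirichletCharacter ℂ q) (s : ℂ) : ℂ :=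
  - (deriv (LFunction χ) s / LFunction χ s)

open Complex DirichletCharacter ArithmeticFunction in
lemma Ld_hasSum {q : ℕ} [NeZero q] (χ : DirichletCharacter ℂ q) (σ t : ℝ) (hσ : 1 < σ) :
    HasSum (fun n : ℕ => (vonMangoldt n / (n:ℝ) ^ σ) * (χ (n : ZMod q) * ((n : ℂ) ^ (t * I))⁻¹).re)
      (Ld χ (σ + t * I)).re := by
  have hs : 1 < (σ + t * I : ℂ).re := by simpa using hσ
  have h := (LSeriesSummable_twist_vonMangoldt χ hs).hasSum
  have e : Ld χ (σ + t * I) = ∑' n, LSeries.term ((fun n : ℕ => χ (n : ZMod q)) * fun n : ℕ => ((vonMangoldt n : ℝ) : ℂ)) (σ + t * I) n := by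
    rw [← LSeries, LSeries_twist_vonMangoldt_eq χ hs, Ld, deriv_LFunction_eq_deriv_LSeries χ hs,
      LFunction_eq_LSeries χ hs, neg_div]
  rw [← e] at h
  have h2 := Complex.hasSum_re h
  convert h2 using 2 with n
  rw [LSeries.term]
  split_ifs with hn
  · subst hn; simp
  · have hn' : (n : ℂ) ≠ 0 := by exact_mod_cast hn
    have : ((n:ℂ) ^ (σ:ℂ)) = (((n:ℝ) ^ σ : ℝ) : ℂ) := by
      rw [ofReal_cpow (Nat.cast_nonneg n)]; simp
    rw [cpow_add _ _ hn', this, ← re_ofReal_mul]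
    congr 1
    simp only [Pi.mul_apply]
    push_cast
    ring

open Complex DirichletCharacter ArithmeticFunction in
lemma Ld_pos {q : ℕ} [NeZero q] (χ₁ χ₂ : DirichletCharacter ℂ q) (σ t₁ t₂ : ℝ) (hσ : 1 < σ) :
    0 ≤ 3 * (Ld (1 : DirichletCharacter ℂ q) (σ + (0:ℝ) * I)).re + 2 * (Ld χ₁ (σ + t₁ * I)).re
      + 2 * (Ld χ₂ (σ + t₂ * I)).re + 2 * (Ld (χ₁ * χ₂⁻¹) (σ + (t₁ - t₂ : ℝ) * I)).re := by
  have h := ((((Ld_hasSum (1 : DirichletCharacter ℂ q) σ 0 hσ).mul_left 3).add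
    ((Ld_hasSum χ₁ σ t₁ hσ).mul_left 2)).add ((Ld_hasSum χ₂ σ t₂ hσ).mul_left 2)).add
    ((Ld_hasSum (χ₁ * χ₂⁻¹) σ (t₁ - t₂) hσ).mul_left 2)
  refine h.nonneg ?_
  intro n
  have hw : 0 ≤ vonMangoldt n / (n:ℝ) ^ σ := div_nonneg vonMangoldt_nonneg (by positivity)
  rcases Nat.eq_zero_or_pos n with rfl | hn
  · simp
  have hn' : (n : ℂ) ≠ 0 := by exact_mod_cast hn.ne'
  by_cases hu : IsUnit (n : ZMod q)
  · have nt : ∀ t : ℝ, ‖(n : ℂ) ^ (t * I)‖ = 1 := by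
      intro t; rw [norm_natCast_cpow_of_pos hn]; simp
    have key := unit_pos (χ₁ (n : ZMod q) * ((n : ℂ) ^ (t₁ * I))⁻¹) (χ₂ (n : ZMod q) * ((n : ℂ) ^ (t₂ * I))⁻¹)
      (by rw [norm_mul, norm_inv, nt]; simpa using χ₁.unit_norm_eq_one hu.unit)
      (by rw [norm_mul, norm_inv, nt]; simpa using χ₂.unit_norm_eq_one hu.unit)
    have e : (χ₁ * χ₂⁻¹) (n : ZMod q) * ((n : ℂ) ^ ((t₁ - t₂ : ℝ) * I))⁻¹ =
        (χ₁ (n : ZMod q) * ((n : ℂ) ^ (t₁ * I))⁻¹) * (χ₂ (n : ZMod q) * ((n : ℂ) ^ (t₂ * I))⁻¹)⁻¹ := by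
      rw [MulChar.mul_apply, MulChar.inv_apply_eq_inv', ofReal_sub, sub_mul, cpow_sub _ _ hn']
      field_simp
    simp only [e]
    rw [MulChar.one_apply hu]
    have e0 : ((1:ℂ) * ((n : ℂ) ^ (((0:ℝ):ℂ) * I))⁻¹).re = 1 := by simp
    rw [e0]
    nlinarith [mul_nonneg hw key]
  · simp [MulChar.map_nonunit _ hu]


open Complex DirichletCharacter in
lemma euler_factor_ne_zero (p : ℕ) (hp : p.Prime) (z s : ℂ) (hz : ‖z‖ ≤ 1) (hs : 0 < s.re) :
    1 - z * (p:ℂ) ^ (-s) ≠ 0 := by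
  intro h
  have h1 : z * (p:ℂ) ^ (-s) = 1 := by linear_combination -h
  have h2 := congrArg norm h1
  rw [norm_mul, norm_natCast_cpow_of_pos hp.pos, norm_one] at h2
  have h3 : (p:ℝ) ^ (-s).re < 1 := by
    apply Real.rpow_lt_one_of_one_lt_of_neg
    · exact_mod_cast hp.one_lt
    · simpa using hs
  have h4 : 0 ≤ (p:ℝ) ^ (-s).re := by positivity
  nlinarith [norm_nonneg z]

open Complex DirichletCharacter Filter Topology in
lemma zeta_near_one : ∃ δ : ℝ, 0 < δ ∧ ∀ (q : ℕ) [NeZero q] (s : ℂ), 0 < s.re →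
    Gfun (1 : DirichletCharacter ℂ q) s = 0 → δ ≤ ‖s - 1‖ := by
  have h := riemannZeta_residue_one.eventually_ne one_ne_zero
  rw [eventually_nhdsWithin_iff, Metric.eventually_nhds_iff] at h
  obtain ⟨δ, hδ, h⟩ := h
  refine ⟨δ, hδ, ?_⟩
  intro q _ s hs hG
  by_contra hcon
  have hs1 : s ≠ 1 := by
    rintro rfl
    exact Gfun_ne_zero _ (by simp) hG
  have := h (y := s) (by rw [dist_eq_norm]; linarith) hs1
  rw [Gfun_one hs1, ← LFunctionTrivChar, LFunctionTrivChar_eq_mul_riemannZeta hs1, mul_eq_zero, mul_eq_zero] at hG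
  rcases hG with hG | hG | hG
  · exact hs1 (sub_eq_zero.mp hG)
  · rw [Finset.prod_eq_zero_iff] at hG
    obtain ⟨p, hp, hp2⟩ := hG
    have := euler_factor_ne_zero p (Nat.prime_of_mem_primeFactors hp) 1 s (by simp) hs
    rw [one_mul] at this; exact this hp2
  · rw [hG] at this; simp at this

open Complex in
lemma re_one_div (x y : ℝ) : (1 / ((x:ℂ) + y * I)).re = x / (x^2 + y^2) := by
  rw [one_div, inv_re, normSq_apply]; simp; ring

set_option maxHeartbeats 1000000 in
open Complex DirichletCharacter in
lemma uniq_core (δ : ℝ) (hδ : 0 < δ) (hz : ∀ (q : ℕ) [NeZero q] (s : ℂ), 0 < s.re →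
    Gfun (1 : DirichletCharacter ℂ q) s = 0 → δ ≤ ‖s - 1‖)
    {q : ℕ} [NeZero q] (χ₁ χ₂ : DirichletCharacter ℂ q) (ρ₁ ρ₂ : ℂ) (a L : ℝ) (ha : 0 < a)
    (ha1 : a ≤ 1/100) (haδ : a ≤ δ / 4) (hL : 1 ≤ L) (haL : a * L = 1/4000)
    (hae : 1 ≤ a * Real.exp L)
    (hz1 : Gfun χ₁ ρ₁ = 0) (hz2 : Gfun χ₂ ρ₂ = 0)
    (hr1 : 1 - ρ₁.re ≤ a / 10) (hr2 : 1 - ρ₂.re ≤ a / 10)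
    (hq1 : q * (|ρ₁.im| + 1) ≤ Real.exp L) (hq2 : q * (|ρ₂.im| + 1) ≤ Real.exp L)
    (hq12 : q * (|ρ₁.im - ρ₂.im| + 1) ≤ Real.exp L) : χ₁ = χ₂ ∧ ρ₁ = ρ₂ := by
  by_contra hne
  have hb1 : ρ₁.re < 1 := by by_contra h; exact Gfun_ne_zero χ₁ (by linarith) hz1
  have hb2 : ρ₂.re < 1 := by by_contra h; exact Gfun_ne_zero χ₂ (by linarith) hz2
  have hpos := Ld_pos χ₁ χ₂ (1 + a) ρ₁.im ρ₂.im (by linarith)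
  have hqq : (q:ℝ) ≤ Real.exp L := by
    have : (0:ℝ) ≤ q := by positivity
    nlinarith [abs_nonneg ρ₁.im]
  -- general bound
  have gen : ∀ (χ : DirichletCharacter ℂ q) (t : ℝ) (S : Finset ℂ), S.card ≤ 2 →
      q * (|t| + 1) ≤ Real.exp L →
      (∀ ρ ∈ S, ‖((1 + a : ℝ) : ℂ) + t * I - ρ‖ < 1/4 ∧ Gfun χ ρ = 0) →
      (Ld χ ((1 + a : ℝ) + t * I)).re ≤ (open Classical in if χ = 1 then a / (a^2 + t^2) else 0)
        - ∑ ρ ∈ S, (1 + a - ρ.re) / ((1 + a - ρ.re)^2 + (t - ρ.im)^2) + 146 * L := by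
    intro χ t S hc hq hS
    have h := key_bound χ ((1 + a : ℝ) + t * I) (by simp; linarith) (by simp; linarith) L hL
      (by simpa using hq) (by simpa using hae) S hc hS
    have e1 : (1 / (((1 + a : ℝ) : ℂ) + t * I - 1)).re = a / (a^2+t^2) := by
      rw [← re_one_div]; congr 2; push_cast; ring
    have e2 : ∀ ρ : ℂ, (1 / (((1 + a : ℝ) : ℂ) + t * I - ρ)).re = (1 + a - ρ.re) / ((1 + a - ρ.re)^2 + (t - ρ.im)^2) := by
      intro ρ
      rw [← re_one_div]; congr 2
      apply Complex.ext <;> simp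
    simp only [e1, e2] at h
    exact h
  have g0 := gen 1 0 ∅ (by simp) (by simpa using hqq) (by simp)
  simp only [if_true, Finset.sum_empty, sub_zero] at g0
  have e0 : a / (a^2 + 0^2) = 1 / a := by field_simp; ring
  rw [e0] at g0
  have g12 := gen (χ₁ * χ₂⁻¹) (ρ₁.im - ρ₂.im) ∅ (by simp) hq12 (by simp)
  simp only [Finset.sum_empty, sub_zero, mul_inv_eq_one] at g12
  -- principal pole
  have pole : ∀ (χ : DirichletCharacter ℂ q) (ρ : ℂ), Gfun χ ρ = 0 → 1 - ρ.re ≤ a / 10 → ρ.re < 1 →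
      (open Classical in if χ = 1 then a / (a^2 + ρ.im^2) else 0) ≤ a / δ^2 := by
    intro χ ρ h1 h2 h3
    split_ifs with h
    · subst h
      have := hz q ρ (by linarith) h1
      have h4 : δ^2 ≤ ‖ρ - 1‖^2 := by gcongr
      rw [Complex.sq_norm, normSq_apply] at h4
      simp at h4
      gcongr
      nlinarith
    · positivity
  have hdist : ∀ ρ : ℂ, 1 - ρ.re ≤ a / 10 → ρ.re < 1 → ∀ t : ℝ, |t - ρ.im| < 1/8 →
      ‖((1 + a : ℝ) : ℂ) + t * I - ρ‖ < 1/4 := by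
    intro ρ h1 h2 t ht
    refine (Complex.norm_le_abs_re_add_abs_im _).trans_lt ?_
    simp
    rw [abs_of_pos (by linarith)]; linarith
  have main : ∀ ρ : ℂ, 1 - ρ.re ≤ a / 10 → ρ.re < 1 →
      10 / 11 * (1/a) ≤ (1 + a - ρ.re) / ((1 + a - ρ.re)^2 + (ρ.im - ρ.im)^2) := by
    intro ρ h1 h2
    have : 0 < 1 + a - ρ.re := by linarith
    have e : (1 + a - ρ.re) / ((1 + a - ρ.re)^2 + (ρ.im - ρ.im)^2) = 1 / (1 + a - ρ.re) := by
      field_simp; ring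
    rw [e, ← mul_div_assoc, div_le_div_iff₀ ha this]; linarith
  have cross : ∀ ρ : ℂ, 1 - ρ.re ≤ a / 10 → ρ.re < 1 → ∀ t : ℝ,
      100/121 * (a / (a^2 + (t - ρ.im)^2)) ≤ (1 + a - ρ.re) / ((1 + a - ρ.re)^2 + (t - ρ.im)^2) := by
    intro ρ h1 h2 t
    have : 0 < 1 + a - ρ.re := by linarith
    have h3 : 100/121 * (a / (a^2 + (t - ρ.im)^2)) = a / (121/100 * a^2 + 121/100*(t - ρ.im)^2) := by
      field_simp
    rw [h3]
    gcongr ?_ / ?_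
    · linarith
    · nlinarith [sq_nonneg (t - ρ.im)]
  have p1 := pole χ₁ ρ₁ hz1 hr1 hb1
  have p2 := pole χ₂ ρ₂ hz2 hr2 hb2
  have m1 := main ρ₁ hr1 hb1
  have m2 := main ρ₂ hr2 hb2
  have fin1 : a / δ^2 ≤ 1/16 * (1/a) := by
    rw [← mul_div_assoc, div_le_div_iff₀ (by positivity) ha]; nlinarith
  have fin2 : L = 1/4000 * (1/a) := by field_simp; linarith
  have fin3 : 0 < 1/a := by positivity
  have fin4 : 64 * a ≤ 64 / 10000 * (1/a) := by
    rw [← mul_div_assoc, le_div_iff₀ ha]; nlinarith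
  by_cases hχ : χ₁ = χ₂
  · have hρ : ρ₁ ≠ ρ₂ := fun h => hne ⟨hχ, h⟩
    simp only [hχ, if_true] at g12
    by_cases hd : |ρ₁.im - ρ₂.im| < 1/8
    · have g1 := gen χ₁ ρ₁.im {ρ₁, ρ₂} (Finset.card_le_two) hq1 (by
        intro ρ hρ'
        rw [Finset.mem_insert, Finset.mem_singleton] at hρ'
        rcases hρ' with rfl | rfl
        · exact ⟨hdist _ hr1 hb1 _ (by simp), hz1⟩
        · exact ⟨hdist _ hr2 hb2 _ hd, by rw [hχ]; exact hz2⟩)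
      have g2 := gen χ₂ ρ₂.im {ρ₁, ρ₂} (Finset.card_le_two) hq2 (by
        intro ρ hρ'
        rw [Finset.mem_insert, Finset.mem_singleton] at hρ'
        rcases hρ' with rfl | rfl
        · exact ⟨hdist _ hr1 hb1 _ (by rw [abs_sub_comm]; exact hd), by rw [← hχ]; exact hz1⟩
        · exact ⟨hdist _ hr2 hb2 _ (by simp), hz2⟩)
      rw [Finset.sum_pair hρ] at g1 g2
      have c1 := cross ρ₂ hr2 hb2 ρ₁.im
      have c2 := cross ρ₁ hr1 hb1 ρ₂.im
      have : (ρ₂.im - ρ₁.im)^2 = (ρ₁.im - ρ₂.im)^2 := by ring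
      rw [this] at c2 g2
      have hX : 0 ≤ a / (a^2 + (ρ₁.im - ρ₂.im)^2) := by positivity
      rw [hχ] at hpos g1 p1
      linarith
    · have hX : a / (a^2 + (ρ₁.im - ρ₂.im)^2) ≤ 64 * a := by
        rw [not_lt] at hd
        have : (1/8)^2 ≤ |ρ₁.im - ρ₂.im|^2 := by gcongr
        rw [sq_abs] at this
        rw [div_le_iff₀ (by positivity)]
        have h5 : a * ((1/8)^2) ≤ a * (a ^ 2 + (ρ₁.im - ρ₂.im)^2) := by
          gcongr; linarith [sq_nonneg a]
        linarith
      have g1 := gen χ₁ ρ₁.im {ρ₁} (by simp) hq1 (by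
        intro ρ hρ'; rw [Finset.mem_singleton] at hρ'; subst hρ'
        exact ⟨hdist _ hr1 hb1 _ (by simp), hz1⟩)
      have g2 := gen χ₂ ρ₂.im {ρ₂} (by simp) hq2 (by
        intro ρ hρ'; rw [Finset.mem_singleton] at hρ'; subst hρ'
        exact ⟨hdist _ hr2 hb2 _ (by simp), hz2⟩)
      rw [Finset.sum_singleton] at g1 g2
      rw [hχ] at hpos g1 p1
      linarith
  · simp only [hχ, if_false] at g12
    have g1 := gen χ₁ ρ₁.im {ρ₁} (by simp) hq1 (by
      intro ρ hρ'; rw [Finset.mem_singleton] at hρ'; subst hρ'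
      exact ⟨hdist _ hr1 hb1 _ (by simp), hz1⟩)
    have g2 := gen χ₂ ρ₂.im {ρ₂} (by simp) hq2 (by
      intro ρ hρ'; rw [Finset.mem_singleton] at hρ'; subst hρ'
      exact ⟨hdist _ hr2 hb2 _ (by simp), hz2⟩)
    rw [Finset.sum_singleton] at g1 g2
    linarith


open Complex DirichletCharacter ComplexConjugate in
lemma LFunction_conj_of_one_lt {q : ℕ} [NeZero q] (χ : DirichletCharacter ℂ q) {s : ℂ} (hs : 1 < s.re) :
    LFunction χ⁻¹ (conj s) = conj (LFunction χ s) := by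
  rw [LFunction_eq_LSeries _ (by simpa using hs), LFunction_eq_LSeries _ hs, LSeries, LSeries, conj_tsum]
  congr 1; ext n
  rw [LSeries.term, LSeries.term]
  split_ifs with h
  · simp
  · rw [map_div₀]
    congr 1
    · rw [← MulChar.star_eq_inv, MulChar.star_apply]; rfl
    · rw [cpow_conj _ _ (by rw [natCast_arg]; exact Real.pi_pos.ne)]; simp

open Complex DirichletCharacter ComplexConjugate in
lemma Gfun_conj {q : ℕ} [NeZero q] (χ : DirichletCharacter ℂ q) (s : ℂ) :
    Gfun χ⁻¹ (conj s) = conj (Gfun χ s) := by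
  have hd : Differentiable ℂ (fun z => conj (Gfun χ (conj z))) := fun z => by
    have := (Gfun_diff χ (conj z)).conj_conj
    simpa [Function.comp_def] using this
  have hopen2 : IsOpen {s : ℂ | 1 < s.re} := isOpen_lt continuous_const continuous_re
  have h := AnalyticOnNhd.eq_of_eventuallyEq (𝕜 := ℂ) (f := Gfun χ⁻¹) (g := fun z => conj (Gfun χ (conj z)))
    (z₀ := 2)
    (fun z _ => (Gfun_diff χ⁻¹).analyticAt z) (fun z _ => hd.analyticAt z) (by
      filter_upwards [hopen2.mem_nhds (show (2:ℂ) ∈ {s : ℂ | 1 < s.re} by simp)] with z hz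
      have hz' : 1 < (conj z).re := by simpa using hz
      have key := LFunction_conj_of_one_lt χ hz'
      rw [conj_conj] at key
      by_cases hχ : χ = 1
      · subst hχ
        rw [inv_one] at key ⊢
        have h1 : z ≠ 1 := by rintro rfl; simp at hz
        have h2 : conj z ≠ 1 := by intro h; rw [h] at hz'; simp at hz'
        rw [Gfun_one h1, Gfun_one h2, key]; simp
      · rw [Gfun_of_ne hχ, Gfun_of_ne (by simpa using hχ), key])
  have := congrFun h (conj s)
  simpa using this

/-- A bad zero. -/
def BadZ (c : ℝ) (q : ℕ) [NeZero q] (χ : DirichletCharacter ℂ q) (s : ℂ) : Prop :=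
  Gfun χ s = 0 ∧ 1 - c / Real.log (q * (|s.im| + 1)) < s.re

lemma uniq_log : ∃ q₀ : ℕ, 1 < q₀ ∧ ∀ (q : ℕ) [NeZero q], q₀ ≤ q → ∀ (χ₁ χ₂ : DirichletCharacter ℂ q) (s₁ s₂ : ℂ)
    (T : ℝ), |s₁.im| ≤ T → |s₂.im| ≤ T → Gfun χ₁ s₁ = 0 → Gfun χ₂ s₂ = 0 →
    1 - (1/80000) / Real.log (q * (T + 1)) < s₁.re → 1 - (1/80000) / Real.log (q * (T + 1)) < s₂.re →
    χ₁ = χ₂ ∧ s₁ = s₂ := by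
  obtain ⟨δ, hδ, hz⟩ := zeta_near_one
  refine ⟨⌈Real.exp (max 1000 (1/(1000*δ)))⌉₊ + 2, by omega, ?_⟩
  intro q _ hq χ₁ χ₂ s₁ s₂ T hT1 hT2 hz1 hz2 hr1 hr2
  have hT0 : 0 ≤ T := (abs_nonneg _).trans hT1
  have hqe : Real.exp (max 1000 (1/(1000*δ))) ≤ q := by
    refine (Nat.le_ceil _).trans ?_
    exact_mod_cast (by omega : ⌈Real.exp (max 1000 (1/(1000*δ)))⌉₊ ≤ q)
  have hq0 : (0:ℝ) < q := (Real.exp_pos _).trans_le hqe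
  have hQ : Real.exp (max 1000 (1/(1000*δ))) ≤ q * (T+1) := by nlinarith
  have hQ0 : 0 < q * (T+1) := by positivity
  set l := Real.log (q * (T + 1)) with hl
  have hlm : max 1000 (1/(1000*δ)) ≤ l := (Real.le_log_iff_exp_le hQ0).mpr hQ
  have hl1 : 1000 ≤ l := (le_max_left _ _).trans hlm
  have hl2 : 1/(1000*δ) ≤ l := (le_max_right _ _).trans hlm
  have hexp : Real.exp (2 * l) = (q * (T+1))^2 := by
    rw [two_mul, Real.exp_add, hl, Real.exp_log hQ0, sq]
  have hq2 : (2:ℝ) ≤ q := by exact_mod_cast (by omega : 2 ≤ q)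
  have hbig : q * (2 * T + 1) ≤ Real.exp (2 * l) := by
    rw [hexp]
    have : 2 ≤ q * (T+1) := by nlinarith
    nlinarith
  have hw : ∀ t : ℝ, |t| ≤ 2 * T → q * (|t| + 1) ≤ Real.exp (2 * l) := by
    intro t ht
    refine le_trans ?_ hbig
    gcongr
  have ha : (0:ℝ) < 1 / (8000 * l) := by positivity
  refine uniq_core δ hδ hz χ₁ χ₂ s₁ s₂ (1/(8000*l)) (2 * l) ha ?_ ?_ (by linarith) ?_ ?_ hz1 hz2 ?_ ?_
    (hw _ (by linarith)) (hw _ (by linarith)) (hw _ ?_)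
  · rw [div_le_div_iff₀ (by positivity) (by norm_num)]; linarith
  · rw [div_le_iff₀ (by positivity)] at hl2 ⊢; nlinarith
  · field_simp; norm_num
  · rw [div_mul_eq_mul_div, one_mul, le_div_iff₀ (by positivity)]
    have := Real.pow_div_factorial_le_exp (2*l) (by linarith) 3
    norm_num [Nat.factorial] at this
    have h6 : 1000 * 1000 ≤ l * l := by nlinarith
    have h7 := mul_le_mul_of_nonneg_right h6 (by linarith : 0 ≤ l)
    have h8 : (2 * l) ^ 3 / 6 = 4/3 * (l * l * l) := by ring
    linarith
  · have : (1/80000) / l = 1/(8000*l)/10 := by field_simp; norm_num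
    linarith
  · have : (1/80000) / l = 1/(8000*l)/10 := by field_simp; norm_num
    linarith
  · have := abs_sub s₁.im s₂.im
    linarith

open ComplexConjugate in
lemma bad_unique : ∃ q₀ : ℕ, 1 < q₀ ∧ ∀ (q : ℕ) [NeZero q], q₀ ≤ q → 
    (∀ (χ : DirichletCharacter ℂ q) (s : ℂ), BadZ (1/80000) q χ s → s.im = 0) ∧
    ∀ (χ₁ χ₂ : DirichletCharacter ℂ q) (s₁ s₂ : ℂ), BadZ (1/80000) q χ₁ s₁ → BadZ (1/80000) q χ₂ s₂ → s₁ = s₂ := by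
  obtain ⟨q₀, h1, h⟩ := uniq_log
  refine ⟨q₀, h1, ?_⟩
  intro q _ hq
  have hreal : ∀ (χ : DirichletCharacter ℂ q) (s : ℂ), BadZ (1/80000) q χ s → s.im = 0 := by
    intro χ s hb
    have := (h q hq χ χ⁻¹ s (conj s) |s.im| le_rfl (by simp) hb.1 (by rw [Gfun_conj, hb.1]; simp) hb.2
      (by simpa using hb.2)).2
    have := congrArg Complex.im this
    simp at this; linarith
  refine ⟨hreal, ?_⟩
  intro χ₁ χ₂ s₁ s₂ hb1 hb2
  have i1 := hreal _ _ hb1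
  have i2 := hreal _ _ hb2
  have r1 := hb1.2
  have r2 := hb2.2
  rw [i1, abs_zero] at r1
  rw [i2, abs_zero] at r2
  exact (h q hq χ₁ χ₂ s₁ s₂ 0 (by simp [i1]) (by simp [i2]) hb1.1 hb2.1 r1 r2).2


open Complex DirichletCharacter Filter Topology HurwitzZeta in
lemma junk_one : ∃ N₀ : ℕ, ∀ (N : ℕ) [NeZero N], N₀ ≤ N →
    LFunction (1 : DirichletCharacter ℂ N) 1 ≠ 0 := by
  refine ⟨⌈Real.exp (1 - (riemannZeta 1).re)⌉₊, ?_⟩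
  intro N _ hN
  have hN0 : 0 < N := NeZero.pos N
  have hNr : (1:ℝ) ≤ N := by exact_mod_cast hN0
  have hNc : (N:ℂ) ≠ 0 := by exact_mod_cast hN0.ne'
  have hlog : 1 - (riemannZeta 1).re ≤ Real.log N := by
    rw [Real.le_log_iff_exp_le (by positivity)]
    exact (Nat.le_ceil _).trans (by exact_mod_cast hN)
  have hlog0 : 0 ≤ Real.log N := Real.log_nonneg hNr
  set P : ℝ → ℝ := fun s => ∏ p ∈ N.primeFactors, (1 - (p:ℝ) ^ (-s)) with hP
  set r : ℝ := P 1 with hr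
  have hpr : ∀ p ∈ N.primeFactors, (2:ℝ) ≤ p := fun p hp => by
    exact_mod_cast (Nat.prime_of_mem_primeFactors hp).two_le
  have hfac : ∀ p ∈ N.primeFactors, (0:ℝ) < 1 - (p:ℝ) ^ (-1:ℝ) := by
    intro p hp
    have := hpr p hp
    rw [Real.rpow_neg_one, sub_pos]
    exact inv_lt_one_of_one_lt₀ (by linarith)
  have hr0 : 0 < r := Finset.prod_pos hfac
  have hPr : ∀ s : ℝ, 1 < s → r ≤ P s := by
    intro s hs
    apply Finset.prod_le_prod (fun p hp => (hfac p hp).le)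
    intro p hp
    have := hpr p hp
    have : (p:ℝ) ^ (-s) ≤ (p:ℝ) ^ (-1:ℝ) := Real.rpow_le_rpow_of_exponent_le (by linarith) (by linarith)
    linarith
  set φ : ℂ := ∑ j : ZMod N, (1 : DirichletCharacter ℂ N) j with hφ
  have hφr : φ = ((r * N : ℝ) : ℂ) := by
    have h1 : φ = ((N.totient : ℝ) : ℂ) := by
      rw [hφ, MulChar.sum_one_eq_card_units, ZMod.card_units_eq_totient]; simp
    have h2 := Nat.totient_eq_mul_prod_factors N
    have h3 : (N.totient : ℝ) = N * ∏ p ∈ N.primeFactors, (1 - (p:ℝ)⁻¹) := by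
      have := congrArg (fun x : ℚ => (x : ℝ)) h2
      push_cast at this
      exact this
    rw [h1, h3, mul_comm]
    simp [hr, hP, Real.rpow_neg_one]
  have hT : Tendsto (fun s : ℝ => (s:ℂ)) (𝓝[>] 1) (𝓝 1) := by
    have := (continuous_ofReal.tendsto (1:ℝ)).mono_left (nhdsWithin_le_nhds (s := Set.Ioi 1))
    simpa using this
  have hG : Tendsto (fun s : ℝ => Gammaℝ s) (𝓝[>] 1) (𝓝 1) := by
    have h1 : Tendsto (fun s : ℂ => (Gammaℝ s)⁻¹) (𝓝 1) (𝓝 ((Gammaℝ 1)⁻¹)) :=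
      (differentiable_Gammaℝ_inv 1).continuousAt.tendsto
    have h2 := (h1.inv₀ (by rw [Gammaℝ_one]; simp)).comp hT
    simpa [Function.comp_def, Gammaℝ_one] using h2
  have hF : Tendsto (fun s : ℝ => (N:ℂ) ^ (-(s:ℂ)) * ∑ j : ZMod N, (1 : DirichletCharacter ℂ N) j *
      (hurwitzZeta (ZMod.toAddCircle j) s - 1 / ((s:ℂ) - 1) / Gammaℝ s)) (𝓝[>] 1)
      (𝓝 (LFunction (1 : DirichletCharacter ℂ N) 1)) := by
    rw [LFunction, ZMod.LFunction]
    apply Tendsto.mul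
    · have : ContinuousAt (fun s : ℂ => (N:ℂ) ^ (-s)) 1 := by
        have : ContinuousAt (fun s : ℂ => -s) 1 := by fun_prop
        exact this.const_cpow (Or.inl hNc)
      exact this.tendsto.comp hT
    · apply tendsto_finsetSum
      intro j _
      apply Tendsto.const_mul
      exact (tendsto_hurwitzZeta_sub_one_div_nhds_one (ZMod.toAddCircle j)).comp hT
  have hZ : Tendsto (fun s : ℝ => riemannZeta s - 1 / ((s:ℂ) - 1) / Gammaℝ s) (𝓝[>] 1) (𝓝 (riemannZeta 1)) :=
    (tendsto_hurwitzZetaEven_sub_one_div_nhds_one 0).comp hT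
  have hPT : Tendsto (fun s : ℝ => ((P s : ℝ) : ℂ)) (𝓝[>] 1) (𝓝 (r:ℂ)) := by
    have : ContinuousAt P 1 := by
      rw [hP]
      apply tendsto_finsetProd
      intro p hp
      have := hpr p hp
      have h0 : (p:ℝ) ≠ 0 := by linarith
      have : ContinuousAt (fun s : ℝ => (p:ℝ) ^ (-s)) 1 := 
        ContinuousAt.rpow continuousAt_const continuousAt_id.neg (Or.inl h0)
      exact tendsto_const_nhds.sub this
    exact (continuous_ofReal.tendsto _).comp (this.tendsto.mono_left nhdsWithin_le_nhds)
  have hD := (hF.mul hG).sub ((hPT.mul hZ).mul hG)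
  set D : ℝ → ℝ := fun s => (P s - r * N * (N:ℝ) ^ (-s)) / (s - 1) with hDdef
  have hD2 : Tendsto (fun s : ℝ => (D s : ℂ)) (𝓝[>] 1)
      (𝓝 (LFunction (1 : DirichletCharacter ℂ N) 1 * 1 - r * riemannZeta 1 * 1)) := by
    refine hD.congr' ?_
    filter_upwards [self_mem_nhdsWithin] with s hs
    have hs' : (1:ℝ) < s := hs
    have hsc : (s:ℂ) ≠ 1 := by exact_mod_cast hs'.ne'
    have hsc' : (s:ℂ) - 1 ≠ 0 := sub_ne_zero.mpr hsc
    have hGn : Gammaℝ (s:ℂ) ≠ 0 := Gammaℝ_ne_zero_of_re_pos (by simp; linarith)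
    have hL : (N:ℂ) ^ (-(s:ℂ)) * ∑ j : ZMod N, (1 : DirichletCharacter ℂ N) j * hurwitzZeta (ZMod.toAddCircle j) s
        = (P s : ℂ) * riemannZeta s := by
      have := LFunctionTrivChar_eq_mul_riemannZeta (N := N) hsc
      rw [LFunctionTrivChar, LFunction, ZMod.LFunction] at this
      rw [this]
      congr 1
      rw [hP]
      push_cast
      apply Finset.prod_congr rfl
      intro p hp
      rw [ofReal_cpow (by positivity)]; simp
    have e1 : ∑ j : ZMod N, (1 : DirichletCharacter ℂ N) j *
      (hurwitzZeta (ZMod.toAddCircle j) s - 1 / ((s:ℂ) - 1) / Gammaℝ s) =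
      ∑ j : ZMod N, (1 : DirichletCharacter ℂ N) j * hurwitzZeta (ZMod.toAddCircle j) s - φ * (1 / ((s:ℂ) - 1) / Gammaℝ s) := by
      rw [hφ, Finset.sum_mul, ← Finset.sum_sub_distrib]
      apply Finset.sum_congr rfl
      intro j _; ring
    rw [e1, mul_sub, hL, hφr, hDdef]
    have e2 : (N:ℂ) ^ (-(s:ℂ)) = (((N:ℝ) ^ (-s) : ℝ) : ℂ) := by
      rw [ofReal_cpow (by positivity)]; simp
    rw [e2]
    push_cast
    field_simp
    ring
  have hD3 := (continuous_re.tendsto _).comp hD2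
  have hlow : Tendsto (fun s : ℝ => r * Real.log N / (1 + (s - 1) * Real.log N)) (𝓝[>] 1) (𝓝 (r * Real.log N)) := by
    have : ContinuousAt (fun s : ℝ => r * Real.log N / (1 + (s - 1) * Real.log N)) 1 := by
      apply ContinuousAt.div
      · fun_prop
      · fun_prop
      · simp
    have := this.tendsto.mono_left (nhdsWithin_le_nhds (s := Set.Ioi 1))
    simpa using this
  have hfin := le_of_tendsto_of_tendsto hlow hD3 (by
    filter_upwards [self_mem_nhdsWithin] with s hs
    have hs' : (1:ℝ) < s := hs
    have hs0 : 0 < s - 1 := by linarith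
    simp only [Function.comp, ofReal_re, hDdef]
    set u := (s - 1) * Real.log N with hu
    have hu0 : 0 ≤ u := by positivity
    have hNs : N * (N:ℝ) ^ (-s) = Real.exp (-u) := by
      have : (N:ℝ) ^ (1 + -s) = N * (N:ℝ) ^ (-s) := by
        rw [Real.rpow_add (by positivity), Real.rpow_one]
      rw [← this, Real.rpow_def_of_pos (by positivity)]
      congr 1; rw [hu]; ring
    have hexp : Real.exp (-u) ≤ 1 / (1 + u) := by
      rw [Real.exp_neg, ← one_div]
      gcongr
      linarith [Real.add_one_le_exp u]
    rw [div_le_div_iff₀ (by positivity) hs0, mul_assoc r (N:ℝ), hNs]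
    have h1 := hPr s hs'
    have h2 : (1 + u) * Real.exp (-u) ≤ 1 := by
      rw [le_div_iff₀ (by positivity)] at hexp; linarith
    have h3 : r * Real.log N * (s - 1) = r * u := by rw [hu]; ring
    rw [h3]
    nlinarith)
  intro hzero
  rw [hzero] at hfin
  simp at hfin
  nlinarith


lemma primorialBelow_pos (x : ℕ) : 0 < primorialBelow x :=
  Finset.prod_pos fun p hp => (Finset.mem_filter.mp hp).2.pos

instance primorialBelow_neZero (x : ℕ) : NeZero (primorialBelow x) := ⟨(primorialBelow_pos x).ne'⟩

lemma primorialBelow_succ (x : ℕ) : primorialBelow (x + 1) = primorialBelow x ∨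
    primorialBelow (x + 1) = x * primorialBelow x := by
  unfold primorialBelow
  rw [Finset.range_add_one, Finset.filter_insert]
  split_ifs with h
  · right; rw [Finset.prod_insert (by simp)]
  · left; rfl

lemma primorialBelow_dvd (x : ℕ) : primorialBelow x ∣ primorialBelow (x + 1) := by
  rcases primorialBelow_succ x with h | h <;> rw [h]
  exact Dvd.intro_left x rfl

lemma le_primorialBelow (x : ℕ) (hx : 8 ≤ x) : x ≤ primorialBelow x := by
  obtain ⟨p, hp, h1, h2⟩ := Nat.exists_prime_lt_and_le_two_mul ((x - 1) / 2) (by omega)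
  have hsub : ({2, p} : Finset ℕ) ⊆ (Finset.range x).filter Nat.Prime := by
    intro y hy
    rw [Finset.mem_insert, Finset.mem_singleton] at hy
    rw [Finset.mem_filter, Finset.mem_range]
    rcases hy with rfl | rfl
    · exact ⟨by omega, Nat.prime_two⟩
    · exact ⟨by omega, hp⟩
  have hd := Finset.prod_dvd_prod_of_subset _ _ (fun p : ℕ => p) hsub
  rw [Finset.prod_pair (by omega)] at hd
  have := Nat.le_of_dvd (primorialBelow_pos x) hd
  omega

open DirichletCharacter in
lemma Gfun_zero_iff {q : ℕ} [NeZero q] (χ : DirichletCharacter ℂ q) {s : ℂ} (hs : s ≠ 1) :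
    Gfun χ s = 0 ↔ LFunction χ s = 0 := by
  by_cases h : χ = 1
  · subst h
    rw [Gfun_one hs, mul_eq_zero]
    simp [sub_ne_zero.mpr hs]
  · rw [Gfun_of_ne h]

open DirichletCharacter in
lemma Gfun_changeLevel {q q' : ℕ} [NeZero q] [NeZero q'] (hd : q ∣ q') (χ : DirichletCharacter ℂ q) {s : ℂ}
    (h : Gfun χ s = 0) : Gfun (changeLevel hd χ) s = 0 := by
  have hs : s ≠ 1 := by rintro rfl; exact Gfun_ne_zero χ (by simp) h
  rw [Gfun_zero_iff _ hs] at h ⊢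
  rw [LFunction_changeLevel hd χ (Or.inr hs), h, zero_mul]

/-- There is `C₂ > 0` such that there are arbitrarily large `x` for which
the primorial modulus `P(x) = ∏_{p<x} p` is good. -/
theorem stmt14 :
    ∃ C₂ > (0 : ℝ), ∀ B : ℕ, ∃ x : ℕ, B ≤ x ∧
      ∃ _ : NeZero (primorialBelow x), IsGoodModulus C₂ (primorialBelow x) := by
  obtain ⟨q₀, hq₀, hu⟩ := bad_unique
  obtain ⟨N₀, hN₀⟩ := junk_one
  refine ⟨1/160000, by norm_num, ?_⟩
  by_contra hcon
  push Not at hcon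
  obtain ⟨B, hB⟩ := hcon
  set B' := B + q₀ + N₀ + 8 with hB'
  have hbad : ∀ x, B' ≤ x → ∃ (χ : DirichletCharacter ℂ (primorialBelow x)) (z : ℂ),
      BadZ (1/160000) (primorialBelow x) χ z := by
    intro x hx
    have h := hB x (by omega) (primorialBelow_neZero x)
    unfold IsGoodModulus at h
    push Not at h
    obtain ⟨χ, s, hs, hz⟩ := h
    have hxP := le_primorialBelow x (by omega)
    refine ⟨χ, s, ?_, hs⟩
    by_cases hχ : χ = 1
    · subst hχ
      have hs1 : s ≠ 1 := by
        rintro rfl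
        exact hN₀ (primorialBelow x) (by omega) hz
      rw [Gfun_zero_iff _ hs1]; exact hz
    · rw [Gfun_of_ne hχ]; exact hz
  have hlogpos : ∀ x, B' ≤ x → 0 < Real.log (primorialBelow x) := by
    intro x hx
    have hxP := le_primorialBelow x (by omega)
    exact Real.log_pos (by exact_mod_cast (by omega : 1 < primorialBelow x))
  have hweak : ∀ x, B' ≤ x → ∀ (χ : DirichletCharacter ℂ (primorialBelow x)) (z : ℂ),
      BadZ (1/160000) (primorialBelow x) χ z → BadZ (1/80000) (primorialBelow x) χ z := by
    intro x hx χ z h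
    refine ⟨h.1, lt_of_le_of_lt ?_ h.2⟩
    have h1 : (1:ℝ) ≤ primorialBelow x := by exact_mod_cast primorialBelow_pos x
    have h2 : 0 ≤ Real.log (primorialBelow x * (|z.im| + 1)) :=
      Real.log_nonneg (by nlinarith [abs_nonneg z.im])
    gcongr
    norm_num
  have hstep : ∀ x, B' ≤ x → ∀ (χ : DirichletCharacter ℂ (primorialBelow x)) (z : ℂ),
      BadZ (1/160000) (primorialBelow x) χ z → ∀ (χ' : DirichletCharacter ℂ (primorialBelow (x+1))) (z' : ℂ),
      BadZ (1/160000) (primorialBelow (x+1)) χ' z' → z' = z := by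
    intro x hx χ z hb χ' z' hb'
    have hxP := le_primorialBelow x (by omega)
    have hxP' := le_primorialBelow (x+1) (by omega)
    have him : z.im = 0 := (hu (primorialBelow x) (by omega)).1 χ z (hweak x hx χ z hb)
    refine (hu (primorialBelow (x+1)) (by omega)).2 χ' (DirichletCharacter.changeLevel (primorialBelow_dvd x) χ)
      z' z (hweak (x+1) (by omega) χ' z' hb') ⟨Gfun_changeLevel _ χ hb.1, ?_⟩
    have h2 := hb.2
    rw [him, abs_zero, zero_add, mul_one] at h2 ⊢
    have l1 := hlogpos x hx
    have l2 := hlogpos (x+1) (by omega)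
    have hle : Real.log (primorialBelow (x+1)) ≤ 2 * Real.log (primorialBelow x) := by
      have h3 : primorialBelow (x+1) ≤ primorialBelow x ^ 2 := by
        have := primorialBelow_pos x
        rcases primorialBelow_succ x with h | h <;> rw [h] <;> nlinarith
      have h4 : (primorialBelow (x+1) : ℝ) ≤ (primorialBelow x : ℝ) ^ 2 := by exact_mod_cast h3
      have h5 := Real.log_le_log (by exact_mod_cast primorialBelow_pos (x+1)) h4
      rw [Real.log_pow] at h5
      exact_mod_cast h5
    refine lt_of_le_of_lt ?_ h2
    have : (1/160000) / Real.log (primorialBelow x) ≤ (1/80000) / Real.log (primorialBelow (x+1)) := by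
      rw [div_le_div_iff₀ l1 l2]; linarith
    linarith
  obtain ⟨χ₀, z, hz⟩ := hbad B' le_rfl
  have hall : ∀ n : ℕ, ∃ χ : DirichletCharacter ℂ (primorialBelow (B' + n)),
      BadZ (1/160000) (primorialBelow (B' + n)) χ z := by
    intro n
    induction n with
    | zero => exact ⟨χ₀, hz⟩
    | succ n ih =>
      obtain ⟨χ, hχ⟩ := ih
      obtain ⟨χ', z', h'⟩ := hbad (B' + n + 1) (by omega)
      have := hstep (B' + n) (by omega) χ z hχ χ' z' h'
      subst this
      exact ⟨χ', h'⟩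
  have hre : z.re < 1 := by
    by_contra h
    exact Gfun_ne_zero χ₀ (by linarith) hz.1
  have hP0 := le_primorialBelow B' (by omega)
  have him : z.im = 0 := (hu (primorialBelow B') (by omega)).1 χ₀ z (hweak B' le_rfl χ₀ z hz)
  set n := ⌈Real.exp (1 / (1 - z.re))⌉₊ with hn
  obtain ⟨χ, hχ⟩ := hall n
  have h2 := hχ.2
  rw [him, abs_zero, zero_add, mul_one] at h2
  have hP1 := le_primorialBelow (B' + n) (by omega)
  have hl := hlogpos (B' + n) (by omega)
  have hε : 0 < 1 - z.re := by linarith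
  have h6 : 1 / (1 - z.re) ≤ Real.log (primorialBelow (B' + n)) := by
    rw [Real.le_log_iff_exp_le (by exact_mod_cast primorialBelow_pos _)]
    refine (Nat.le_ceil _).trans ?_
    exact_mod_cast (by omega : n ≤ primorialBelow (B' + n))
  have h7 : 1 - z.re < 1/160000 / Real.log (primorialBelow (B' + n)) := by linarith
  rw [lt_div_iff₀ hl] at h7
  rw [div_le_iff₀ hε] at h6
  linarith
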